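/- arXiv:1809.05572 — 3 statements merged into one kernel-verified Lean document; each statement's English description precedes it below -/
import Mathlib

section
/- Let σ > 0, let y_1, …, y_n ∈ ℝ^d, and let 𝒫 be a class of probability measures on ℝ^d with finite second moments that is closed under domination (i.e., if P ∈ 𝒫 and Q ≪ P then Q ∈ 𝒫). Let U = (1/n) Σ_{i=1}^n δ_{y_i} be the empirical measure. Then a measure P̂ ∈ 𝒫 maximizes the Gaussian deconvolution log-likelihood P ↦ Σ_{i=1}^n log (φ_σ ⋆ dP)(y_i) over 𝒫 if and only if P̂ minimizes P ↦ W_{σ²}(P, U) over 𝒫, where W_{σ²} is the entropic optimal transport distance. In other words, the maximum-likelihood estimator for Gaussian deconvolution is the projection of the empirical measure onto 𝒫 with respect to W_{σ²}. -/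
open MeasureTheory ProbabilityTheory Real
open scoped ENNReal

noncomputable section
open Classical in

/-- The Kullback–Leibler divergence `D(μ ‖ ν)`, valued in `ℝ≥0∞`.
It equals `∫ log (dμ/dν) dμ` when `μ ≪ ν` and this integral is defined,
and `∞` otherwise.  (For probability measures the integral, when defined,
is nonnegative, so no truncation occurs.) -/
def KLdiv {α : Type*} [MeasurableSpace α] (μ ν : Measure α) : ℝ≥0∞ :=
  if μ ≪ ν ∧ Integrable (fun x => Real.log (μ.rnDeriv ν x).toReal) μ then
    ENNReal.ofReal (∫ x, Real.log (μ.rnDeriv ν x).toReal ∂μ)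
  else ⊤

/-- The mutual information `I(γ) = D(γ ‖ π_X γ ⊗ π_Y γ)` of a measure on a product space. -/
def mutualInfo {α β : Type*} [MeasurableSpace α] [MeasurableSpace β]
    (γ : Measure (α × β)) : ℝ≥0∞ :=
  KLdiv γ ((γ.map Prod.fst).prod (γ.map Prod.snd))

/-- The set of couplings of `μ` and `ν` : probability measures on the product with
first marginal `μ` and second marginal `ν`. -/
def couplings {α : Type*} [MeasurableSpace α] (μ ν : Measure α) :
    Set (Measure (α × α)) :=
  {γ | IsProbabilityMeasure γ ∧ γ.map Prod.fst = μ ∧ γ.map Prod.snd = ν}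

/-- The entropic optimal transport distance `W_{σ²}(μ, ν)`. -/
def entropicOT {E : Type*} [NormedAddCommGroup E] [MeasurableSpace E]
    (σ : ℝ) (μ ν : Measure E) : ℝ≥0∞ :=
  ⨅ γ ∈ couplings μ ν,
    (∫⁻ p, ENNReal.ofReal (‖p.1 - p.2‖ ^ 2 / 2) ∂γ)
      + ENNReal.ofReal (σ ^ 2) * mutualInfo γ

/-- The density `φ_σ` of the centered Gaussian `N(0, σ² I_d)` on `ℝ^d`. -/
def gaussDensity (σ : ℝ) (d : ℕ) (z : EuclideanSpace ℝ (Fin d)) : ℝ :=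
  (2 * π * σ ^ 2) ^ (-(d : ℝ) / 2) * Real.exp (-‖z‖ ^ 2 / (2 * σ ^ 2))

/-- The empirical measure `(1/n) ∑ δ_{y i}`. -/
def empirical {α : Type*} [MeasurableSpace α] {n : ℕ} (y : Fin n → α) : Measure α :=
  (n : ℝ≥0∞)⁻¹ • ∑ i, Measure.dirac (y i)


lemma KLdiv_eq_klDiv {α : Type*} [MeasurableSpace α] (μ ν : Measure α)
    [IsProbabilityMeasure μ] [IsProbabilityMeasure ν] :
    KLdiv μ ν = InformationTheory.klDiv μ ν := by
  rw [InformationTheory.klDiv_def, KLdiv]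
  simp only [llr_def, probReal_univ, add_sub_cancel_right]
  congr

/-- If `μ` and `ν` are probability measures, the divergence of `γ` from `μ ⊗ ν` splits into the
divergence of its first marginal from `μ` and its divergence from the product of its first marginal
with `ν`. -/
lemma klDiv_prod_eq_add {α β : Type*} [MeasurableSpace α] [MeasurableSpace β]
    [StandardBorelSpace β] [Nonempty β] (γ : Measure (α × β)) [IsProbabilityMeasure γ]
    (μ : Measure α) (ν : Measure β) [IsProbabilityMeasure μ] [IsProbabilityMeasure ν] :
    InformationTheory.klDiv γ (μ.prod ν) =
      InformationTheory.klDiv (γ.map Prod.fst) μ +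
        InformationTheory.klDiv γ ((γ.map Prod.fst).prod ν) := by
  have h := InformationTheory.klDiv_compProd_eq_add (μ := γ.fst) (ν := μ)
    (κ := γ.condKernel) (η := Kernel.const α ν)
  rw [Measure.compProd_const, Measure.compProd_const] at h
  have e : γ.fst.compProd γ.condKernel = γ := Measure.disintegrate γ γ.condKernel
  rw [e] at h
  exact h

section Gibbs

variable {E : Type*} [NormedAddCommGroup E] [MeasurableSpace E]

/-- The partition function `y ↦ ∫ exp (-‖x - y‖² / (2 s)) dP(x)`. -/
def partitionFun (s : ℝ) (P : Measure E) (y : E) : ℝ :=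
  ∫ x, Real.exp (-(‖x - y‖ ^ 2 / 2) / s) ∂P

/-- The exponent whose tilting of `P ⊗ U` is the Gibbs coupling. -/
def gibbsPotential (s : ℝ) (P : Measure E) (p : E × E) : ℝ :=
  -(‖p.1 - p.2‖ ^ 2 / 2) / s - Real.log (partitionFun s P p.2)

lemma gibbs_map_fst_absolutelyContinuous (s : ℝ) (P U : Measure E) [IsProbabilityMeasure U] :
    ((P.prod U).tilted (gibbsPotential s P)).map Prod.fst ≪ P := by
  have h := (tilted_absolutelyContinuous (P.prod U) (gibbsPotential s P)).map
    (measurable_fst (α := E) (β := E))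
  rwa [Measure.map_fst_prod, measure_univ, one_smul] at h

variable [BorelSpace E]

lemma integrable_exp_neg_sq {s : ℝ} (hs : 0 < s) (P : Measure E) [IsProbabilityMeasure P] (y : E) :
    Integrable (fun x => Real.exp (-(‖x - y‖ ^ 2 / 2) / s)) P := by
  have hc : Continuous fun x : E => Real.exp (-(‖x - y‖ ^ 2 / 2) / s) := by fun_prop
  refine (integrable_const (1 : ℝ)).mono' hc.measurable.aestronglyMeasurable ?_
  filter_upwards with x
  rw [Real.norm_eq_abs, Real.abs_exp, Real.exp_le_one_iff]
  exact div_nonpos_of_nonpos_of_nonneg (by simp; positivity) hs.le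

lemma partitionFun_pos {s : ℝ} (hs : 0 < s) (P : Measure E) [IsProbabilityMeasure P] (y : E) :
    0 < partitionFun s P y :=
  integral_exp_pos (integrable_exp_neg_sq hs P y)

lemma log_partitionFun_nonpos {s : ℝ} (hs : 0 < s) (P : Measure E) [IsProbabilityMeasure P]
    (y : E) : Real.log (partitionFun s P y) ≤ 0 := by
  refine Real.log_nonpos (partitionFun_pos hs P y).le ?_
  calc partitionFun s P y ≤ ∫ _, (1 : ℝ) ∂P := by
        refine integral_mono (integrable_exp_neg_sq hs P y) (integrable_const _) fun x => ?_
        simp only [Real.exp_le_one_iff]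
        exact div_nonpos_of_nonpos_of_nonneg (by simp; positivity) hs.le
    _ = 1 := by simp

lemma lintegral_exp_gibbsPotential {s : ℝ} (hs : 0 < s) (P : Measure E) [IsProbabilityMeasure P]
    (y : E) :
    ∫⁻ x, ENNReal.ofReal (Real.exp (gibbsPotential s P (x, y))) ∂P = 1 := by
  have e : (fun x => Real.exp (gibbsPotential s P (x, y))) =
      fun x => Real.exp (-(‖x - y‖ ^ 2 / 2) / s) / partitionFun s P y := by
    funext x
    simp only [gibbsPotential]
    rw [Real.exp_sub, Real.exp_log (partitionFun_pos hs P y)]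
  rw [← ofReal_integral_eq_lintegral_ofReal]
  · rw [e, integral_div]
    change ENNReal.ofReal (partitionFun s P y / partitionFun s P y) = 1
    rw [div_self (partitionFun_pos hs P y).ne', ENNReal.ofReal_one]
  · rw [e]
    exact (integrable_exp_neg_sq hs P y).div_const _
  · filter_upwards with x using (Real.exp_pos _).le

variable [SecondCountableTopology E]

lemma measurable_sq_norm_sub_div_two : Measurable fun p : E × E => ‖p.1 - p.2‖ ^ 2 / 2 := by
  have : Continuous fun p : E × E => ‖p.1 - p.2‖ ^ 2 / 2 := by fun_prop
  exact this.measurable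

lemma measurable_partitionFun (s : ℝ) (P : Measure E) [SFinite P] :
    Measurable (partitionFun s P) := by
  have h : StronglyMeasurable fun p : E × E => Real.exp (-(‖p.1 - p.2‖ ^ 2 / 2) / s) :=
    ((measurable_sq_norm_sub_div_two.neg.div_const s).exp).stronglyMeasurable
  exact h.integral_prod_left.measurable

lemma measurable_gibbsPotential (s : ℝ) (P : Measure E) [SFinite P] :
    Measurable (gibbsPotential s P) :=
  (measurable_sq_norm_sub_div_two.neg.div_const s).sub
    ((measurable_partitionFun s P).comp measurable_snd).log

variable {s : ℝ} (hs : 0 < s) (P U : Measure E) [IsProbabilityMeasure P] [IsProbabilityMeasure U]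

include hs

lemma lintegral_exp_gibbsPotential_prod :
    ∫⁻ p, ENNReal.ofReal (Real.exp (gibbsPotential s P p)) ∂(P.prod U) = 1 := by
  rw [lintegral_prod_symm' _ (measurable_gibbsPotential s P).exp.ennreal_ofReal]
  simp [lintegral_exp_gibbsPotential hs P]

lemma integrable_exp_gibbsPotential :
    Integrable (fun p => Real.exp (gibbsPotential s P p)) (P.prod U) := by
  refine ⟨(measurable_gibbsPotential s P).exp.aestronglyMeasurable, ?_⟩
  rw [hasFiniteIntegral_iff_ofReal (by filter_upwards with p using (Real.exp_pos _).le),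
    lintegral_exp_gibbsPotential_prod hs P U]
  exact ENNReal.one_lt_top

lemma integral_exp_gibbsPotential :
    ∫ p, Real.exp (gibbsPotential s P p) ∂(P.prod U) = 1 := by
  rw [integral_eq_lintegral_of_nonneg_ae (by filter_upwards with p using (Real.exp_pos _).le)
    (measurable_gibbsPotential s P).exp.aestronglyMeasurable,
    lintegral_exp_gibbsPotential_prod hs P U, ENNReal.toReal_one]

lemma isProbabilityMeasure_gibbs :
    IsProbabilityMeasure ((P.prod U).tilted (gibbsPotential s P)) :=
  isProbabilityMeasure_tilted (integrable_exp_gibbsPotential hs P U)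

lemma gibbs_map_snd :
    ((P.prod U).tilted (gibbsPotential s P)).map Prod.snd = U := by
  ext A hA
  rw [Measure.map_apply measurable_snd hA, tilted_apply' _ _ (measurable_snd hA),
    integral_exp_gibbsPotential hs P U]
  simp only [div_one]
  rw [← Set.univ_prod, ← Measure.prod_restrict, Measure.restrict_univ,
    lintegral_prod_symm' _ (measurable_gibbsPotential s P).exp.ennreal_ofReal]
  simp [lintegral_exp_gibbsPotential hs P]

/-- The entropic cost of `γ` relative to `P ⊗ U` is, up to an additive constant, its divergence from
the Gibbs coupling. -/
lemma integral_add_mul_klDiv_eq (γ : Measure (E × E)) [IsProbabilityMeasure γ]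
    (hγ : γ ≪ P.prod U) (hsnd : γ.map Prod.snd = U)
    (hq : Integrable (fun p => ‖p.1 - p.2‖ ^ 2 / 2) γ)
    (hZ : Integrable (fun y => Real.log (partitionFun s P y)) U)
    (hl : Integrable (llr γ (P.prod U)) γ) :
    ∫ p, ‖p.1 - p.2‖ ^ 2 / 2 ∂γ + s * (InformationTheory.klDiv γ (P.prod U)).toReal =
      s * (InformationTheory.klDiv γ ((P.prod U).tilted (gibbsPotential s P))).toReal
        + -s * ∫ y, Real.log (partitionFun s P y) ∂U := by
  have := isProbabilityMeasure_gibbs hs P U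
  have hZ' : Integrable (fun p : E × E => Real.log (partitionFun s P p.2)) γ := by
    rw [← hsnd] at hZ
    exact hZ.comp_measurable measurable_snd
  have hq' : Integrable (fun p : E × E => -(‖p.1 - p.2‖ ^ 2 / 2) / s) γ := hq.neg.div_const s
  have hf : Integrable (gibbsPotential s P) γ := hq'.sub hZ'
  have hfi : ∫ p, gibbsPotential s P p ∂γ =
      -(∫ p, ‖p.1 - p.2‖ ^ 2 / 2 ∂γ) / s - ∫ y, Real.log (partitionFun s P y) ∂U := by
    simp only [gibbsPotential]
    rw [integral_sub hq' hZ', integral_div, integral_neg]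
    congr 1
    conv_rhs => rw [← hsnd]
    rw [integral_map measurable_snd.aemeasurable
      (measurable_partitionFun s P).log.aestronglyMeasurable]
  have hexp := integrable_exp_gibbsPotential hs P U
  rw [InformationTheory.toReal_klDiv_of_measure_eq hγ (by simp),
    InformationTheory.toReal_klDiv_of_measure_eq
      (hγ.trans (absolutelyContinuous_tilted hexp)) (by simp),
    integral_llr_tilted_right hγ hf hexp hl, hfi, integral_exp_gibbsPotential hs P U, Real.log_one]
  field_simp
  ring

/-- The normalised negative log-likelihood bounds the entropic transport cost from below. -/
lemma ofReal_neg_integral_log_le_entropicOT {σ : ℝ} (hσ : s = σ ^ 2)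
    (hZ : Integrable (fun y => Real.log (partitionFun s P y)) U) :
    ENNReal.ofReal (-s * ∫ y, Real.log (partitionFun s P y) ∂U) ≤ entropicOT σ P U := by
  refine le_iInf₂ fun γ hγ => ?_
  obtain ⟨hp, h1, h2⟩ := hγ
  rw [mutualInfo, h1, h2, KLdiv_eq_klDiv, ← hσ]
  by_cases hk : InformationTheory.klDiv γ (P.prod U) = ⊤
  · rw [hk, ENNReal.mul_top (by simpa using hs)]
    simp
  by_cases hc : ∫⁻ p, ENNReal.ofReal (‖p.1 - p.2‖ ^ 2 / 2) ∂γ = ⊤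
  · rw [hc]
    simp
  have hnn : 0 ≤ᵐ[γ] fun p : E × E => ‖p.1 - p.2‖ ^ 2 / 2 := by
    filter_upwards with p
    positivity
  have hq : Integrable (fun p : E × E => ‖p.1 - p.2‖ ^ 2 / 2) γ :=
    ⟨measurable_sq_norm_sub_div_two.aestronglyMeasurable,
      (hasFiniteIntegral_iff_ofReal hnn).2 (lt_top_iff_ne_top.2 hc)⟩
  have hac := InformationTheory.klDiv_ne_top_iff.1 hk
  have key := integral_add_mul_klDiv_eq hs P U γ hac.1 h2 hq hZ hac.2
  rw [← ofReal_integral_eq_lintegral_ofReal hq hnn, ← ENNReal.ofReal_toReal hk,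
    ← ENNReal.ofReal_mul hs.le, ← ENNReal.ofReal_add (integral_nonneg_of_ae hnn) (by positivity),
    key]
  exact ENNReal.ofReal_le_ofReal (le_add_of_nonneg_left (by positivity))

/-- The first marginal of the Gibbs coupling has entropic transport cost at most the normalised
negative log-likelihood of `P`, with a gain given by its divergence from `P`. -/
lemma entropicOT_gibbs_add_le [StandardBorelSpace E] {σ : ℝ} (hσ : s = σ ^ 2)
    (hZ : Integrable (fun y => Real.log (partitionFun s P y)) U)
    (hq : Integrable (fun p => ‖p.1 - p.2‖ ^ 2 / 2) ((P.prod U).tilted (gibbsPotential s P))) :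
    entropicOT σ (((P.prod U).tilted (gibbsPotential s P)).map Prod.fst) U
        + ENNReal.ofReal s * InformationTheory.klDiv
          (((P.prod U).tilted (gibbsPotential s P)).map Prod.fst) P
      ≤ ENNReal.ofReal (-s * ∫ y, Real.log (partitionFun s P y) ∂U) := by
  have hp := isProbabilityMeasure_gibbs hs P U
  have h2 := gibbs_map_snd hs P U
  have hexp := integrable_exp_gibbsPotential hs P U
  have hll := log_rnDeriv_tilted_left_self hexp
  have hac := tilted_absolutelyContinuous (P.prod U) (gibbsPotential s P)
  have hone := integral_exp_gibbsPotential hs P U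
  set γ := (P.prod U).tilted (gibbsPotential s P) with hγ
  have hp1 : IsProbabilityMeasure (γ.map Prod.fst) :=
    Measure.isProbabilityMeasure_map measurable_fst.aemeasurable
  have hnn : 0 ≤ᵐ[γ] fun p : E × E => ‖p.1 - p.2‖ ^ 2 / 2 := by
    filter_upwards with p
    positivity
  have hZ' : Integrable (fun p : E × E => Real.log (partitionFun s P p.2)) γ := by
    rw [← h2] at hZ
    exact hZ.comp_measurable measurable_snd
  have hf : Integrable (gibbsPotential s P) γ := (hq.neg.div_const s).sub hZ'
  have hl : Integrable (llr γ (P.prod U)) γ := by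
    refine hf.congr ?_
    filter_upwards [hac.ae_le hll] with p hp
    rw [llr_def]
    simp only
    rw [hp, hone, Real.log_one, sub_zero]
  have key := integral_add_mul_klDiv_eq hs P U γ hac h2 hq hZ hl
  rw [← hγ, InformationTheory.klDiv_self, ENNReal.toReal_zero, mul_zero, zero_add] at key
  have hk := InformationTheory.klDiv_ne_top hac hl
  calc _ ≤ (∫⁻ p, ENNReal.ofReal (‖p.1 - p.2‖ ^ 2 / 2) ∂γ
          + ENNReal.ofReal (σ ^ 2) * mutualInfo γ)
          + ENNReal.ofReal s * InformationTheory.klDiv (γ.map Prod.fst) P := by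
        gcongr
        exact iInf₂_le γ ⟨hp, rfl, h2⟩
    _ = ∫⁻ p, ENNReal.ofReal (‖p.1 - p.2‖ ^ 2 / 2) ∂γ
          + ENNReal.ofReal s * InformationTheory.klDiv γ (P.prod U) := by
        have : Nonempty E := ⟨0⟩
        rw [mutualInfo, h2, KLdiv_eq_klDiv, klDiv_prod_eq_add γ P U, ← hσ]
        ring
    _ = _ := by
        rw [← ofReal_integral_eq_lintegral_ofReal hq hnn, ← ENNReal.ofReal_toReal hk,
          ← ENNReal.ofReal_mul hs.le,
          ← ENNReal.ofReal_add (integral_nonneg_of_ae hnn) (by positivity), key]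

end Gibbs

section Empirical

variable {α : Type*} [MeasurableSpace α] {n : ℕ} (y : Fin n → α)

lemma isProbabilityMeasure_empirical (hn : 0 < n) : IsProbabilityMeasure (empirical y) := by
  constructor
  simp only [empirical, Measure.smul_apply, Measure.finsetSum_apply, measure_univ, smul_eq_mul]
  simp only [Finset.sum_const, Finset.card_univ, Fintype.card_fin, nsmul_eq_mul, mul_one]
  exact ENNReal.inv_mul_cancel (by exact_mod_cast hn.ne') (ENNReal.natCast_ne_top n)

lemma integrable_empirical (hn : 0 < n) {f : α → ℝ} (hf : Measurable f) :
    Integrable f (empirical y) := by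
  refine Integrable.smul_measure ?_ (by simpa using hn.ne')
  rw [integrable_finsetSum_measure]
  exact fun i _ => integrable_dirac' hf.stronglyMeasurable (by simp)

lemma integral_empirical {f : α → ℝ} (hf : Measurable f) :
    ∫ x, f x ∂(empirical y) = (n : ℝ)⁻¹ * ∑ i, f (y i) := by
  rw [empirical, integral_smul_measure, integral_finsetSum_measure]
  · simp [integral_dirac' _ _ hf.stronglyMeasurable]
  · exact fun i _ => integrable_dirac' hf.stronglyMeasurable (by simp)

end Empirical

/-- A coupling of measures with finite second moments has finite quadratic cost. -/
lemma integrable_sq_norm_sub_div_two {E : Type*} [NormedAddCommGroup E] [MeasurableSpace E]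
    [BorelSpace E] [SecondCountableTopology E] {γ : Measure (E × E)}
    (h1 : Integrable (fun x => ‖x‖ ^ 2) (γ.map Prod.fst))
    (h2 : Integrable (fun x => ‖x‖ ^ 2) (γ.map Prod.snd)) :
    Integrable (fun p => ‖p.1 - p.2‖ ^ 2 / 2) γ := by
  refine ((h1.comp_measurable measurable_fst).add (h2.comp_measurable measurable_snd)).mono'
    measurable_sq_norm_sub_div_two.aestronglyMeasurable ?_
  filter_upwards with p
  have h := norm_sub_le p.1 p.2
  have h0 := norm_nonneg (p.1 - p.2)
  rw [Real.norm_of_nonneg (by positivity)]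
  simp only [Pi.add_apply, Function.comp_apply]
  nlinarith [sq_nonneg (‖p.1‖ - ‖p.2‖)]

lemma log_integral_gaussDensity {d : ℕ} {σ : ℝ} (hσ : 0 < σ)
    (P : Measure (EuclideanSpace ℝ (Fin d))) [IsProbabilityMeasure P]
    (y : EuclideanSpace ℝ (Fin d)) :
    Real.log (∫ x, gaussDensity σ d (y - x) ∂P) =
      Real.log ((2 * π * σ ^ 2) ^ (-(d : ℝ) / 2)) + Real.log (partitionFun (σ ^ 2) P y) := by
  have hs : 0 < σ ^ 2 := by positivity
  have e : ∫ x, gaussDensity σ d (y - x) ∂P =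
      (2 * π * σ ^ 2) ^ (-(d : ℝ) / 2) * partitionFun (σ ^ 2) P y := by
    rw [partitionFun, ← integral_const_mul]
    refine integral_congr_ae (ae_of_all _ fun x => ?_)
    simp only [gaussDensity]
    rw [norm_sub_rev y x]
    congr 2
    field_simp
  rw [e, Real.log_mul (by positivity) (partitionFun_pos hs P y).ne']

/-- **Entropic optimal transport is maximum-likelihood deconvolution**
(Theorem 1 of Rigollet–Weed).  Let `Pclass` be a class of probability measures on `ℝ^d`
with finite second moments that is closed under domination.  Then `P̂ ∈ Pclass` maximizes
the Gaussian deconvolution log-likelihood `P ↦ ∑ i, log (φ_σ ⋆ dP)(y i)` over `Pclass`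
if and only if `P̂` minimizes `P ↦ W_{σ²}(P, U)` over `Pclass`, where
`U = (1/n) ∑ i, δ_{y i}` is the empirical measure. -/
theorem mle_iff_entropicOT_proj {d n : ℕ} (hn : 0 < n) (σ : ℝ) (hσ : 0 < σ)
    (y : Fin n → EuclideanSpace ℝ (Fin d))
    (Pclass : Set (Measure (EuclideanSpace ℝ (Fin d))))
    (hprob : ∀ P ∈ Pclass, IsProbabilityMeasure P)
    (hmom : ∀ P ∈ Pclass, Integrable (fun x => ‖x‖ ^ 2) P)
    (hdom : ∀ P ∈ Pclass, ∀ Q : Measure (EuclideanSpace ℝ (Fin d)),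
      IsProbabilityMeasure Q → Q ≪ P → Q ∈ Pclass)
    (Phat : Measure (EuclideanSpace ℝ (Fin d))) (hPhat : Phat ∈ Pclass) :
    (∀ P ∈ Pclass, ∑ i, Real.log (∫ x, gaussDensity σ d (y i - x) ∂P)
        ≤ ∑ i, Real.log (∫ x, gaussDensity σ d (y i - x) ∂Phat)) ↔
    (∀ P ∈ Pclass, entropicOT σ Phat (empirical y) ≤ entropicOT σ P (empirical y)) := by
  have hU := isProbabilityMeasure_empirical y hn
  have hs : 0 < σ ^ 2 := by positivity
  set U := empirical y with hUdef
  set F : Measure (EuclideanSpace ℝ (Fin d)) → ℝ :=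
    fun P => -σ ^ 2 * ∫ z, Real.log (partitionFun (σ ^ 2) P z) ∂U with hF
  have hFnn : ∀ P ∈ Pclass, 0 ≤ F P := fun P hP => by
    have := hprob P hP
    exact mul_nonneg_of_nonpos_of_nonpos (by linarith)
      (integral_nonpos fun z => log_partitionFun_nonpos hs P z)
  have hlik : ∀ P ∈ Pclass, ∀ Q ∈ Pclass,
      (∑ i, Real.log (∫ x, gaussDensity σ d (y i - x) ∂P)
        ≤ ∑ i, Real.log (∫ x, gaussDensity σ d (y i - x) ∂Q)) ↔ F Q ≤ F P := by
    intro P hP Q hQ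
    have := hprob P hP
    have := hprob Q hQ
    have hn' : (0 : ℝ) < (n : ℝ)⁻¹ := by positivity
    simp only [hF, hUdef, log_integral_gaussDensity hσ, Finset.sum_add_distrib,
      integral_empirical y (measurable_partitionFun (σ ^ 2) _).log]
    rw [add_le_add_iff_left, neg_mul, neg_mul, neg_le_neg_iff, mul_le_mul_iff_right₀ hs,
      mul_le_mul_iff_right₀ hn']
  have hlow : ∀ P ∈ Pclass, ENNReal.ofReal (F P) ≤ entropicOT σ P U := fun P hP => by
    have := hprob P hP
    exact ofReal_neg_integral_log_le_entropicOT hs P U rfl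
      (integrable_empirical y hn (measurable_partitionFun _ P).log)
  have hup : ∀ P ∈ Pclass, ∃ Q ∈ Pclass, entropicOT σ Q U
      + ENNReal.ofReal (σ ^ 2) * InformationTheory.klDiv Q P ≤ ENNReal.ofReal (F P) := by
    intro P hP
    have := hprob P hP
    have := isProbabilityMeasure_gibbs hs P U
    have hQ := hdom P hP _ (Measure.isProbabilityMeasure_map measurable_fst.aemeasurable)
      (gibbs_map_fst_absolutelyContinuous (σ ^ 2) P U)
    refine ⟨_, hQ, entropicOT_gibbs_add_le hs P U rfl
      (integrable_empirical y hn (measurable_partitionFun _ P).log)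
      (integrable_sq_norm_sub_div_two (hmom _ hQ) ?_)⟩
    rw [gibbs_map_snd hs P U]
    exact integrable_empirical y hn (measurable_norm.pow_const 2)
  constructor
  · intro h P hP
    obtain ⟨Q, hQ, hle⟩ := hup Phat hPhat
    have := hprob Q hQ
    have := hprob Phat hPhat
    have hFQ := (hlik Q hQ Phat hPhat).1 (h Q hQ)
    have hk : InformationTheory.klDiv Q Phat = 0 := by
      have h3 : ENNReal.ofReal (F Phat) + ENNReal.ofReal (σ ^ 2) * InformationTheory.klDiv Q Phat
          ≤ ENNReal.ofReal (F Phat) + 0 := by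
        rw [add_zero]
        exact (add_le_add_left ((ENNReal.ofReal_le_ofReal hFQ).trans (hlow Q hQ)) _).trans hle
      have h4 := (ENNReal.add_le_add_iff_left ENNReal.ofReal_ne_top).1 h3
      rw [nonpos_iff_eq_zero, mul_eq_zero, ENNReal.ofReal_eq_zero] at h4
      exact h4.resolve_left hs.not_ge
    rw [hk, mul_zero, add_zero, InformationTheory.klDiv_eq_zero_iff.1 hk] at hle
    exact hle.trans ((ENNReal.ofReal_le_ofReal ((hlik P hP Phat hPhat).1 (h P hP))).trans
      (hlow P hP))
  · intro h P hP
    obtain ⟨Q, hQ, hle⟩ := hup P hP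
    rw [hlik P hP Phat hPhat, ← ENNReal.ofReal_le_ofReal_iff (hFnn P hP)]
    exact (hlow Phat hPhat).trans ((h Q hQ).trans (le_self_add.trans hle))

end
end

section
/- Let σ > 0 and define the probability measures P_1 := (1/2)(δ_0 + δ_{4σ}) and P_2 := (1/2)(δ_{2σ} + δ_{6σ}) on ℝ. Let X ∼ P_1 and Y = X + Z where Z ∼ N(0, σ²) is independent of X. Then with probability at least 0.15, both of the following hold simultaneously: (i) W_{σ²}(P_1, δ_Y) < W_{σ²}(P_2, δ_Y), so P_1 is the unique minimizer of P ↦ W_{σ²}(P, δ_Y) over {P_1, P_2}; and (ii) (φ_σ ⋆ dP_2)(Y) > (φ_σ ⋆ dP_1)(Y), so P_2 is the unique maximizer of the log-likelihood P ↦ log (φ_σ ⋆ dP)(Y) over {P_1, P_2}. In other words, the maximum-likelihood estimator and the entropic optimal transport projection disagree with probability at least 0.15. -/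
open MeasureTheory ProbabilityTheory Real
open scoped ENNReal

noncomputable section
/-- The density `φ_σ` of the one-dimensional centered Gaussian `N(0, σ²)`. -/
def gaussDensity1 (σ : ℝ) (z : ℝ) : ℝ :=
  (2 * π * σ ^ 2) ^ (-(1 : ℝ) / 2) * Real.exp (-z ^ 2 / (2 * σ ^ 2))

lemma couplings_dirac {E : Type*} [MeasurableSpace E] [MeasurableSingletonClass E]
    (P : Measure E) [IsProbabilityMeasure P] (y : E) :
    couplings P (Measure.dirac y) = {P.prod (Measure.dirac y)} := by
  ext γ
  simp only [couplings, Set.mem_ofPred_eq, Set.mem_singleton_iff]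
  constructor
  · rintro ⟨-, h1, h2⟩
    have hae : ∀ᵐ p ∂γ, p.2 = y := by
      have h : ∀ᵐ z ∂(γ.map Prod.snd), z = y := by
        simp [h2]
      exact ae_of_ae_map measurable_snd.aemeasurable h
    have hγ : γ = γ.map (fun p => (p.1, y)) := by
      conv_lhs => rw [← Measure.map_id (μ := γ)]
      refine Measure.map_congr ?_
      filter_upwards [hae] with p hp
      exact Prod.ext rfl hp
    rw [Measure.prod_dirac, ← h1, Measure.map_map (by fun_prop) (by fun_prop)]
    exact hγ
  · rintro rfl
    refine ⟨inferInstance, ?_, ?_⟩ <;> simp [Measure.map_fst_prod, Measure.map_snd_prod]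

lemma KLdiv_self {α : Type*} [MeasurableSpace α] (μ : Measure α) [SigmaFinite μ] :
    KLdiv μ μ = 0 := by
  have h : (fun x => Real.log (μ.rnDeriv μ x).toReal) =ᵐ[μ] fun _ => 0 := by
    filter_upwards [Measure.rnDeriv_self μ] with x hx
    simp [hx]
  rw [KLdiv, if_pos ⟨Measure.AbsolutelyContinuous.rfl,
    (integrable_zero _ _ _).congr h.symm⟩, integral_congr_ae h]
  simp

lemma entropicOT_dirac (σ : ℝ) (P : Measure ℝ) [IsProbabilityMeasure P] (y : ℝ) :
    entropicOT σ P (Measure.dirac y) = ∫⁻ x, ENNReal.ofReal (‖x - y‖ ^ 2 / 2) ∂P := by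
  have hI : mutualInfo (P.prod (Measure.dirac y)) = 0 := by
    rw [mutualInfo, Measure.map_fst_prod, Measure.map_snd_prod]
    simp [KLdiv_self]
  rw [entropicOT, couplings_dirac]
  simp only [Set.mem_singleton_iff, iInf_iInf_eq_left, hI, mul_zero, add_zero]
  rw [Measure.prod_dirac, lintegral_map (by fun_prop) (by fun_prop)]

lemma isProbabilityMeasure_two_diracs (a b : ℝ) :
    IsProbabilityMeasure ((2 : ℝ≥0∞)⁻¹ • (Measure.dirac a + Measure.dirac b)) := by
  constructor
  simp only [Measure.smul_apply, Measure.add_apply, measure_univ, smul_eq_mul]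
  rw [one_add_one_eq_two, ENNReal.inv_mul_cancel (by simp) (by simp)]

lemma entropicOT_two_diracs (σ a b y : ℝ) :
    entropicOT σ ((2 : ℝ≥0∞)⁻¹ • (Measure.dirac a + Measure.dirac b)) (Measure.dirac y) =
      ENNReal.ofReal (((a - y) ^ 2 + (b - y) ^ 2) / 4) := by
  have := isProbabilityMeasure_two_diracs a b
  rw [entropicOT_dirac, lintegral_smul_measure, lintegral_add_measure, lintegral_dirac,
    lintegral_dirac, ← ENNReal.ofReal_add (by positivity) (by positivity), smul_eq_mul,
    show (2 : ℝ≥0∞)⁻¹ = ENNReal.ofReal (2⁻¹) by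
      rw [ENNReal.ofReal_inv_of_pos two_pos]; simp,
    ← ENNReal.ofReal_mul (by norm_num)]
  congr 1
  simp only [Real.norm_eq_abs, sq_abs]
  ring

lemma integral_two_diracs (f : ℝ → ℝ) (a b : ℝ) :
    ∫ x, f x ∂((2 : ℝ≥0∞)⁻¹ • (Measure.dirac a + Measure.dirac b)) = (f a + f b) / 2 := by
  rw [integral_smul_measure, integral_add_measure (integrable_dirac (by simp))
    (integrable_dirac (by simp)), integral_dirac, integral_dirac]
  simp
  ring

lemma exp_add_exp_neg_lt : exp 3.98 + exp (-3.98) + 1 < exp 4 := by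
  have h4 : (54 : ℝ) ≤ exp 4 := by
    have h := Real.exp_one_gt_d9
    have : exp 4 = exp 1 ^ 4 := by rw [← Real.exp_nat_mul]; norm_num
    rw [this]
    calc (54 : ℝ) ≤ 2.718 ^ 4 := by norm_num
      _ ≤ _ := by gcongr; linarith
  have hmul : exp 3.98 = exp 4 * exp (-0.02) := by rw [← Real.exp_add]; norm_num
  have hmul' : exp 4 = exp 3.98 * exp 0.02 := by rw [← Real.exp_add]; norm_num
  have h1 : (0.98 : ℝ) ≤ exp (-0.02) := by
    have := Real.add_one_le_exp (-0.02 : ℝ); linarith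
  have h2 : (1.02 : ℝ) ≤ exp 0.02 := by
    have := Real.add_one_le_exp (0.02 : ℝ); linarith
  have h3 : (52.9 : ℝ) ≤ exp 3.98 := by rw [hmul]; nlinarith
  have h5 : exp (-3.98) * exp 3.98 = 1 := by rw [← Real.exp_add]; norm_num
  have h6 : exp (-3.98) ≤ 0.02 := by nlinarith [Real.exp_pos (-3.98)]
  nlinarith

lemma exp_sum_lt {u : ℝ} (h1 : 1.01 < u) (h2 : u < 3) :
    exp (-u ^ 2 / 2) + exp (-(u - 4) ^ 2 / 2) <
      exp (-(u - 2) ^ 2 / 2) + exp (-(u - 6) ^ 2 / 2) := by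
  set s := exp (2 * (u - 3)) with hs
  set E := exp (-u ^ 2 / 2) with hE
  have e1 : exp (-(u - 4) ^ 2 / 2) = E * (s ^ 2 * exp 4) := by
    rw [hE, hs, ← Real.exp_nat_mul, ← Real.exp_add, ← Real.exp_add]; congr 1; push_cast; ring
  have e2 : exp (-(u - 2) ^ 2 / 2) = E * (s * exp 4) := by
    rw [hE, hs, ← Real.exp_add, ← Real.exp_add]; congr 1; ring
  have e3 : exp (-(u - 6) ^ 2 / 2) = E * s ^ 3 := by
    rw [hE, hs, ← Real.exp_nat_mul, ← Real.exp_add]; congr 1; push_cast; ring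
  have hs1 : s < 1 := by rw [hs, Real.exp_lt_one_iff]; linarith
  have hs0 : exp (-3.98) < s := by rw [hs, Real.exp_lt_exp]; linarith
  have hspos : 0 < s := Real.exp_pos _
  have hbig : 1 < exp 3.98 := by rw [Real.one_lt_exp_iff]; norm_num
  have hmul : exp (-3.98) * exp 3.98 = 1 := by rw [← Real.exp_add]; norm_num
  have hq : s ^ 2 + 1 < s * (exp 3.98 + exp (-3.98)) := by
    nlinarith [mul_pos (sub_pos.2 hs0) (sub_pos.2 (hs1.trans hbig))]
  have hq' : s ^ 2 + 1 < s * (exp 4 - 1) :=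
    hq.trans (by gcongr; linarith [exp_add_exp_neg_lt])
  have hmain : 1 + s ^ 2 * exp 4 < s * exp 4 + s ^ 3 := by
    nlinarith [mul_pos (sub_pos.2 hs1) (sub_pos.2 hq')]
  rw [e1, e2, e3]
  have hEpos : 0 < E := Real.exp_pos _
  nlinarith [mul_lt_mul_of_pos_left hmain hEpos]

lemma gaussDensity1_sum_lt {σ u : ℝ} (hσ : 0 < σ) (h1 : 1.01 < u) (h2 : u < 3) :
    gaussDensity1 σ (σ * u - 0) + gaussDensity1 σ (σ * u - 4 * σ) <
      gaussDensity1 σ (σ * u - 2 * σ) + gaussDensity1 σ (σ * u - 6 * σ) := by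
  have key (c : ℝ) : -(σ * u - c * σ) ^ 2 / (2 * σ ^ 2) = -(u - c) ^ 2 / 2 := by
    field_simp
  have key0 : -(σ * u - 0) ^ 2 / (2 * σ ^ 2) = -u ^ 2 / 2 := by simpa using key 0
  simp only [gaussDensity1, key, key0, ← mul_add]
  have : 0 < 2 * π * σ ^ 2 := by positivity
  exact mul_lt_mul_of_pos_left (exp_sum_lt h1 h2) (by positivity)

lemma exp_mul_le_integral_exp_neg_sq_half (c : ℝ) {h : ℝ} (hh : 0 ≤ h) :
    exp (-(c ^ 2 / 2)) * (2 * h - h ^ 3 / 3) ≤ ∫ x in (c - h)..(c + h), exp (-x ^ 2 / 2) := by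
  have hint : ∫ x in (c - h)..(c + h), exp (-(c ^ 2 / 2)) * (1 + c ^ 2 / 2 - x ^ 2 / 2) =
      exp (-(c ^ 2 / 2)) * (2 * h - h ^ 3 / 3) := by
    rw [intervalIntegral.integral_const_mul, intervalIntegral.integral_sub
      (by simp) (Continuous.intervalIntegrable (by fun_prop) _ _),
      intervalIntegral.integral_div, integral_pow, intervalIntegral.integral_const, smul_eq_mul]
    push_cast
    ring
  rw [← hint]
  refine intervalIntegral.integral_mono_on (by linarith)
    (Continuous.intervalIntegrable (by fun_prop) _ _)
    (Continuous.intervalIntegrable (by fun_prop) _ _) fun x _ => ?_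
  have hsplit : exp (-x ^ 2 / 2) = exp (-(c ^ 2 / 2)) * exp (c ^ 2 / 2 - x ^ 2 / 2) := by
    rw [← Real.exp_add]
    congr 1
    ring
  rw [hsplit]
  gcongr
  linarith [Real.add_one_le_exp (c ^ 2 / 2 - x ^ 2 / 2)]

lemma le_integral_exp_neg_sq_half {a b c h : ℝ} (ha : c - h = a) (hb : c + h = b) (hh : 0 ≤ h)
    (hh3 : h ≤ 1) (hc : c ^ 2 / 2 ≤ 256) :
    (1 - c ^ 2 / 2 / 256) ^ 256 * (2 * h - h ^ 3 / 3) ≤ ∫ x in a..b, exp (-x ^ 2 / 2) := by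
  subst ha hb
  refine le_trans ?_ (exp_mul_le_integral_exp_neg_sq_half c hh)
  have hexp := Real.one_sub_div_pow_le_exp_neg (n := 256) (t := c ^ 2 / 2) (by exact_mod_cast hc)
  push_cast at hexp
  refine mul_le_mul_of_nonneg_right hexp ?_
  nlinarith [mul_nonneg hh (sub_nonneg.2 hh3), mul_nonneg (mul_nonneg hh hh) (sub_nonneg.2 hh3)]

lemma integral_exp_neg_sq_half_lower :
    0.15 * √(2 * π) ≤ ∫ x in (1.01 : ℝ)..2.99, exp (-x ^ 2 / 2) := by
  have hI (a b : ℝ) : IntervalIntegrable (fun x : ℝ => exp (-x ^ 2 / 2)) volume a b :=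
    Continuous.intervalIntegrable (by fun_prop) _ _
  have hsum : ∫ x in (1.01 : ℝ)..2.99, exp (-x ^ 2 / 2) =
      (∫ x in (1.01 : ℝ)..1.34, exp (-x ^ 2 / 2)) + (∫ x in (1.34 : ℝ)..1.67, exp (-x ^ 2 / 2)) +
      (∫ x in (1.67 : ℝ)..2, exp (-x ^ 2 / 2)) + (∫ x in (2 : ℝ)..2.33, exp (-x ^ 2 / 2)) +
      (∫ x in (2.33 : ℝ)..2.66, exp (-x ^ 2 / 2)) + ∫ x in (2.66 : ℝ)..2.99, exp (-x ^ 2 / 2) := by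
    simp only [intervalIntegral.integral_add_adjacent_intervals (hI _ _) (hI _ _)]
  have hsqrt : √(2 * π) ≤ 2.507 := by
    rw [Real.sqrt_le_left (by norm_num)]
    linarith [Real.pi_lt_d4]
  have b1 := le_integral_exp_neg_sq_half (a := 1.01) (b := 1.34) (c := 1.175) (h := 0.165)
    (by norm_num) (by norm_num) (by norm_num) (by norm_num) (by norm_num)
  have b2 := le_integral_exp_neg_sq_half (a := 1.34) (b := 1.67) (c := 1.505) (h := 0.165)
    (by norm_num) (by norm_num) (by norm_num) (by norm_num) (by norm_num)
  have b3 := le_integral_exp_neg_sq_half (a := 1.67) (b := 2) (c := 1.835) (h := 0.165)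
    (by norm_num) (by norm_num) (by norm_num) (by norm_num) (by norm_num)
  have b4 := le_integral_exp_neg_sq_half (a := 2) (b := 2.33) (c := 2.165) (h := 0.165)
    (by norm_num) (by norm_num) (by norm_num) (by norm_num) (by norm_num)
  have b5 := le_integral_exp_neg_sq_half (a := 2.33) (b := 2.66) (c := 2.495) (h := 0.165)
    (by norm_num) (by norm_num) (by norm_num) (by norm_num) (by norm_num)
  have b6 := le_integral_exp_neg_sq_half (a := 2.66) (b := 2.99) (c := 2.825) (h := 0.165)
    (by norm_num) (by norm_num) (by norm_num) (by norm_num) (by norm_num)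
  rw [hsum]
  refine le_trans ?_ (add_le_add (add_le_add (add_le_add (add_le_add (add_le_add b1 b2) b3) b4)
    b5) b6)
  refine (mul_le_mul_of_nonneg_left hsqrt (by norm_num)).trans ?_
  norm_num

lemma gaussianReal_Ioo_lower :
    ENNReal.ofReal 0.15 ≤ gaussianReal 0 1 (Set.Ioo 1.01 2.99) := by
  rw [gaussianReal_apply_eq_integral _ one_ne_zero, ← integral_Ioc_eq_integral_Ioo,
    ← intervalIntegral.integral_of_le (by norm_num)]
  refine ENNReal.ofReal_le_ofReal ?_
  simp only [gaussianPDFReal, sub_zero, NNReal.coe_one, mul_one,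
    intervalIntegral.integral_const_mul]
  have hpos : 0 < √(2 * π) := by positivity
  rw [inv_mul_eq_div, le_div_iff₀ hpos]
  exact integral_exp_neg_sq_half_lower

lemma gaussianReal_eq_map_const_mul (σ : ℝ) :
    gaussianReal 0 (σ ^ 2).toNNReal = (gaussianReal 0 1).map (σ * ·) := by
  rw [gaussianReal_map_const_mul, mul_zero, mul_one]
  congr 1
  exact Real.toNNReal_of_nonneg (sq_nonneg σ)

lemma gaussianReal_Ioo_mul {σ : ℝ} (hσ : 0 < σ) (a b : ℝ) :
    gaussianReal 0 (σ ^ 2).toNNReal (Set.Ioo (σ * a) (σ * b)) =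
      gaussianReal 0 1 (Set.Ioo a b) := by
  rw [gaussianReal_eq_map_const_mul, Measure.map_apply (by fun_prop) measurableSet_Ioo]
  congr 1
  ext x
  simp only [Set.mem_preimage, Set.mem_Ioo, mul_lt_mul_iff_right₀ hσ]

lemma gaussianReal_Ioo_neg (a b : ℝ) :
    gaussianReal 0 1 (Set.Ioo (-b) (-a)) = gaussianReal 0 1 (Set.Ioo a b) := by
  have h := gaussianReal_map_neg (μ := 0) (v := 1)
  rw [neg_zero] at h
  conv_rhs => rw [← h, Measure.map_apply measurable_neg measurableSet_Ioo]
  congr 1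
  ext x
  simp only [Set.mem_Ioo, Set.mem_preimage]
  constructor <;> rintro ⟨h1, h2⟩ <;> constructor <;> linarith

lemma entropicOT_lt_and_likelihood_lt {σ u : ℝ} (hσ : 0 < σ) (h1 : 1.01 < u) (h2 : u < 3) :
    entropicOT σ ((2 : ℝ≥0∞)⁻¹ • (Measure.dirac (0 : ℝ) + Measure.dirac (4 * σ)))
        (Measure.dirac (σ * u)) <
      entropicOT σ ((2 : ℝ≥0∞)⁻¹ • (Measure.dirac (2 * σ) + Measure.dirac (6 * σ)))
        (Measure.dirac (σ * u)) ∧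
    ∫ x, gaussDensity1 σ (σ * u - x)
        ∂((2 : ℝ≥0∞)⁻¹ • (Measure.dirac (0 : ℝ) + Measure.dirac (4 * σ))) <
      ∫ x, gaussDensity1 σ (σ * u - x)
        ∂((2 : ℝ≥0∞)⁻¹ • (Measure.dirac (2 * σ) + Measure.dirac (6 * σ))) := by
  rw [entropicOT_two_diracs, entropicOT_two_diracs, integral_two_diracs, integral_two_diracs]
  constructor
  · have h : 0 < σ ^ 2 * (3 - u) := mul_pos (pow_pos hσ 2) (sub_pos.2 h2)
    rw [ENNReal.ofReal_lt_ofReal_iff_of_nonneg (by positivity)]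
    nlinarith
  · linarith [gaussDensity1_sum_lt hσ h1 h2]

/-- **MLE and entropic projection can disagree** (Proposition 2 of Rigollet–Weed).
Let `P₁ = (1/2)(δ₀ + δ_{4σ})`, `P₂ = (1/2)(δ_{2σ} + δ_{6σ})`, let `X ∼ P₁` and
`Y = X + Z` with `Z ∼ N(0, σ²)` independent of `X`.  Then, with probability at
least `0.15`, simultaneously `P₁` is the unique minimizer of `P ↦ W_{σ²}(P, δ_Y)`
over `{P₁, P₂}` and `P₂` is the unique maximizer of the likelihood
`P ↦ (φ_σ ⋆ dP)(Y)` over `{P₁, P₂}`. -/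
theorem mle_and_entropicOT_disagree (σ : ℝ) (hσ : 0 < σ)
    {Ω : Type*} [MeasurableSpace Ω] (μ : Measure Ω) [IsProbabilityMeasure μ]
    (X Z : Ω → ℝ) (hX : Measurable X) (hZ : Measurable Z)
    (hXlaw : μ.map X = (2 : ℝ≥0∞)⁻¹ • (Measure.dirac (0 : ℝ) + Measure.dirac (4 * σ)))
    (hZlaw : μ.map Z = gaussianReal 0 (σ ^ 2).toNNReal)
    (hindep : IndepFun X Z μ) :
    ENNReal.ofReal 0.15 ≤
      μ {ω | entropicOT σ ((2 : ℝ≥0∞)⁻¹ • (Measure.dirac (0 : ℝ) + Measure.dirac (4 * σ)))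
              (Measure.dirac (X ω + Z ω))
            < entropicOT σ ((2 : ℝ≥0∞)⁻¹ • (Measure.dirac (2 * σ) + Measure.dirac (6 * σ)))
              (Measure.dirac (X ω + Z ω)) ∧
          (∫ x, gaussDensity1 σ (X ω + Z ω - x)
              ∂((2 : ℝ≥0∞)⁻¹ • (Measure.dirac (0 : ℝ) + Measure.dirac (4 * σ))))
            < ∫ x, gaussDensity1 σ (X ω + Z ω - x)
              ∂((2 : ℝ≥0∞)⁻¹ • (Measure.dirac (2 * σ) + Measure.dirac (6 * σ)))} := by
  have hXhalf (c : ℝ) (hc : c = 0 ∨ c = 4 * σ) : μ (X ⁻¹' {c}) = 2⁻¹ := by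
    rw [← Measure.map_apply hX (measurableSet_singleton c), hXlaw]
    rcases hc with rfl | rfl <;> simp [hσ.ne']
  have hZprob (a b : ℝ) : μ (Z ⁻¹' Set.Ioo (σ * a) (σ * b)) = gaussianReal 0 1 (Set.Ioo a b) := by
    rw [← Measure.map_apply hZ measurableSet_Ioo, hZlaw, gaussianReal_Ioo_mul hσ]
  set A := X ⁻¹' {0} ∩ Z ⁻¹' Set.Ioo (σ * 1.01) (σ * 2.99) with hA
  set B := X ⁻¹' {4 * σ} ∩ Z ⁻¹' Set.Ioo (σ * -2.99) (σ * -1.01) with hB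
  have hμA : μ A = 2⁻¹ * gaussianReal 0 1 (Set.Ioo 1.01 2.99) := by
    rw [hA, hindep.measure_inter_preimage_eq_mul _ _ (measurableSet_singleton _)
      measurableSet_Ioo, hXhalf _ (Or.inl rfl), hZprob]
  have hμB : μ B = 2⁻¹ * gaussianReal 0 1 (Set.Ioo 1.01 2.99) := by
    rw [hB, hindep.measure_inter_preimage_eq_mul _ _ (measurableSet_singleton _)
      measurableSet_Ioo, hXhalf _ (Or.inr rfl), hZprob, gaussianReal_Ioo_neg]
  have hBmeas : MeasurableSet B :=
    (hX (measurableSet_singleton _)).inter (hZ measurableSet_Ioo)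
  have hdisj : Disjoint A B := by
    rw [Set.disjoint_left]
    rintro ω ⟨h1, -⟩ ⟨h2, -⟩
    simp only [Set.mem_preimage, Set.mem_singleton_iff] at h1 h2
    linarith
  have hunion : μ (A ∪ B) = gaussianReal 0 1 (Set.Ioo 1.01 2.99) := by
    rw [measure_union hdisj hBmeas, hμA, hμB, ← add_mul, ENNReal.inv_two_add_inv_two, one_mul]
  refine (gaussianReal_Ioo_lower.trans hunion.ge).trans (measure_mono ?_)
  intro ω hω
  obtain ⟨u, hu, h1, h2⟩ : ∃ u, X ω + Z ω = σ * u ∧ 1.01 < u ∧ u < 3 := by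
    refine ⟨(X ω + Z ω) / σ, by field_simp, ?_⟩
    rw [lt_div_iff₀ hσ, div_lt_iff₀ hσ]
    rcases hω with ⟨hx, hz⟩ | ⟨hx, hz⟩ <;>
      simp only [Set.mem_preimage, Set.mem_singleton_iff, Set.mem_Ioo] at hx hz <;>
      rw [hx] <;> constructor <;> linarith
  rw [Set.mem_ofPred_eq, hu]
  exact entropicOT_lt_and_likelihood_lt hσ h1 h2

end
end

section
/- For every real number t with 1.01 ≤ t < 3, one has exp(−t²/2) + exp(−(t − 4)²/2) < exp(−(t − 2)²/2) + exp(−(t − 6)²/2). -/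
/-- A convex quadratic that is negative at `y` and at `1` is negative between them. -/
lemma sq_add_self_add_one_lt_mul {E x y : ℝ} (hyx : y ≤ x) (hx : x ≤ 1) (hE : 3 ≤ E)
    (hy : y ^ 2 + y + 1 < E * y) : x ^ 2 + x + 1 < E * x := by
  nlinarith [mul_nonneg (sub_nonneg.2 hyx) (sub_nonneg.2 hx),
    mul_nonneg (sub_nonneg.2 hyx) (by linarith : 0 ≤ E - 2 - y)]

/-- For every real `t` with `1.01 ≤ t < 3`,
`exp(−t²/2) + exp(−(t − 4)²/2) < exp(−(t − 2)²/2) + exp(−(t − 6)²/2)`. -/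
theorem gaussian_likelihood_ineq (t : ℝ) (h1 : 1.01 ≤ t) (h2 : t < 3) :
    Real.exp (-t ^ 2 / 2) + Real.exp (-(t - 4) ^ 2 / 2)
      < Real.exp (-(t - 2) ^ 2 / 2) + Real.exp (-(t - 6) ^ 2 / 2) := by
  set A := Real.exp (-t ^ 2 / 2) with hA
  set x := Real.exp (2 * t - 6) with hx
  set E := Real.exp 4 with hE
  set y := Real.exp (-3.98) with hy
  have e4 : Real.exp (-(t - 4) ^ 2 / 2) = A * (E * x ^ 2) := by
    rw [hA, hE, hx, ← Real.exp_nat_mul, ← Real.exp_add, ← Real.exp_add]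
    congr 1; push_cast; ring
  have e2 : Real.exp (-(t - 2) ^ 2 / 2) = A * (E * x) := by
    rw [hA, hE, hx, ← Real.exp_add, ← Real.exp_add]
    congr 1; ring
  have e6 : Real.exp (-(t - 6) ^ 2 / 2) = A * x ^ 3 := by
    rw [hA, hx, ← Real.exp_nat_mul, ← Real.exp_add]
    congr 1; push_cast; ring
  have hyx : y ≤ x := Real.exp_le_exp.2 (by linarith)
  have hx1 : x < 1 := by rw [hx, Real.exp_lt_one_iff]; linarith
  have hy0 : 0 < y := Real.exp_pos _
  have hE53 : 53 < E := by
    have h : E = Real.exp 1 ^ 4 := by rw [hE, ← Real.exp_nat_mul]; norm_num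
    calc (53 : ℝ) < 2.7 ^ 4 := by norm_num
      _ ≤ Real.exp 1 ^ 4 := by
        gcongr
        linarith [Real.exp_one_gt_d9]
      _ = E := h.symm
  have hEy : E * y = Real.exp 0.02 := by
    rw [hE, hy, ← Real.exp_add]; norm_num
  have hlow : 1.0202 ≤ Real.exp 0.02 := by
    linarith [Real.quadratic_le_exp_of_nonneg (x := 0.02) (by norm_num)]
  have hup : Real.exp 0.02 ≤ 1 / (1 - 0.02) := by
    exact Real.exp_bound_div_one_sub_of_interval (by norm_num) (by norm_num)
  have hy195 : y < 0.0195 := by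
    norm_num at hup
    nlinarith
  have hyE : y ^ 2 + y + 1 < E * y := by
    rw [hEy]
    nlinarith
  have hq := sq_add_self_add_one_lt_mul hyx hx1.le (by linarith) hyE
  have hpoly : 1 + E * x ^ 2 < E * x + x ^ 3 := by
    nlinarith [mul_pos (sub_pos.2 hx1) (sub_pos.2 hq)]
  rw [e4, e2, e6]
  nlinarith [mul_lt_mul_of_pos_left hpoly (Real.exp_pos (-t ^ 2 / 2))]
end
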